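/- For every d ≥ 1 and p ≥ 0 there exists a constant C (depending only on d and p) such that the following holds: for every γ ∈ (0,1] and every matrix M : ℤ^d × ℤ^d → ℂ with |M_a^b| ≤ e^{−γ|a−b|} for all a, b ∈ ℤ^d, and for every z : ℤ^d → ℂ with ‖z‖_p < ∞, the sequence (Mz)_a = ∑_{b∈ℤ^d} M_a^b z_b is well defined and satisfies ‖Mz‖_p ≤ C·γ^{−(d+p)}·‖z‖_p. -/

import Mathlib

/-- The Euclidean norm of a lattice point `a ∈ ℤ^d`. -/
noncomputable def latNorm {d : ℕ} (a : Fin d → ℤ) : ℝ :=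
  Real.sqrt (∑ i, ((a i : ℝ)) ^ 2)

/-- The weight `⟨a⟩^{2p}` with `⟨a⟩ = max(|a|,1)` of the weighted `ℓ²` norm
`‖z‖_p = (∑_a ⟨a⟩^{2p}|z_a|²)^{1/2}`. -/
noncomputable def latWeight {d : ℕ} (p : ℝ) (a : Fin d → ℤ) : ℝ :=
  (max (latNorm a) 1) ^ (2 * p)

open scoped ENNReal

theorem ENNReal.two_mul_mul_le_sq_add_sq (x y : ℝ≥0∞) : 2 * x * y ≤ x ^ 2 + y ^ 2 := by
  induction x with
  | top => simp
  | coe x =>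
    induction y with
    | top => simp
    | coe y => exact_mod_cast two_mul_le_add_sq x y

/-- Young inequality `‖k * w‖₂ ≤ ‖k‖₁ ‖w‖₂` for nonnegative functions on a discrete group. -/
theorem ENNReal.tsum_sq_conv_le {G : Type*} [AddCommGroup G] (k w : G → ℝ≥0∞) :
    ∑' a, (∑' b, k (a - b) * w b) ^ 2 ≤ (∑' c, k c) ^ 2 * ∑' b, w b ^ 2 := by
  have hleft (a : G) : ∑' b, k (a - b) = ∑' c, k c := (Equiv.subLeft a).tsum_eq k
  have hright (b : G) : ∑' a, k (a - b) = ∑' c, k c := (Equiv.subRight b).tsum_eq k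
  have cauchy_schwarz (a : G) : (∑' b, k (a - b) * w b) ^ 2 ≤
      (∑' c, k c) * ∑' b, k (a - b) * w b ^ 2 := by
    refine (ENNReal.mul_le_mul_iff_right two_ne_zero ENNReal.ofNat_ne_top).1 ?_
    calc 2 * (∑' b, k (a - b) * w b) ^ 2
        = ∑' b, ∑' c, k (a - b) * k (a - c) * (2 * w b * w c) := by
          rw [sq, ← ENNReal.tsum_mul_right, ← ENNReal.tsum_mul_left]
          refine tsum_congr fun b => ?_
          rw [← ENNReal.tsum_mul_left, ← ENNReal.tsum_mul_left]
          exact tsum_congr fun c => by ring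
      _ ≤ ∑' b, ∑' c, k (a - b) * k (a - c) * (w b ^ 2 + w c ^ 2) := by
          gcongr with b c
          exact ENNReal.two_mul_mul_le_sq_add_sq _ _
      _ = ∑' b, ∑' c, (k (a - b) * w b ^ 2 * k (a - c) + k (a - b) * (k (a - c) * w c ^ 2)) :=
          tsum_congr fun b => tsum_congr fun c => by ring
      _ = 2 * ((∑' c, k c) * ∑' b, k (a - b) * w b ^ 2) := by
          simp_rw [ENNReal.tsum_add, ENNReal.tsum_mul_left, ENNReal.tsum_mul_right, hleft]
          ring
  calc ∑' a, (∑' b, k (a - b) * w b) ^ 2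
      ≤ ∑' a, (∑' c, k c) * ∑' b, k (a - b) * w b ^ 2 := ENNReal.tsum_le_tsum cauchy_schwarz
    _ = (∑' c, k c) ^ 2 * ∑' b, w b ^ 2 := by
      rw [ENNReal.tsum_mul_left, ENNReal.tsum_comm]
      simp_rw [ENNReal.tsum_mul_right, hright, ENNReal.tsum_mul_left]
      ring

theorem ENNReal.tsum_pi_prod_eq_pow {ι : Type*} (f : ι → ℝ≥0∞) (d : ℕ) :
    ∑' c : Fin d → ι, ∏ i, f (c i) = (∑' n, f n) ^ d := by
  induction d with
  | zero => simp
  | succ d ih =>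
    rw [← (Fin.consEquiv fun _ => ι).tsum_eq, ENNReal.tsum_prod']
    simp [Fin.prod_univ_succ, Fin.consEquiv, ENNReal.tsum_mul_left, ENNReal.tsum_mul_right, ih,
      pow_succ']

theorem tsum_int_exp_neg_mul_abs_le {s : ℝ} (hs : 0 < s) (hs1 : s ≤ 1) :
    ∑' n : ℤ, ENNReal.ofReal (Real.exp (-(s * |(n : ℝ)|))) ≤ ENNReal.ofReal (4 / s) := by
  have hr0 : 0 ≤ Real.exp (-s) := (Real.exp_pos _).le
  have hr1 : Real.exp (-s) < 1 := by simpa using hs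
  have hgeom := hasSum_geometric_of_lt_one hr0 hr1
  have key : HasSum (fun n : ℤ => Real.exp (-(s * |(n : ℝ)|)))
      ((1 - Real.exp (-s))⁻¹ + Real.exp (-s) * (1 - Real.exp (-s))⁻¹) := by
    refine HasSum.of_nat_of_neg_add_one ?_ ?_
    · refine hgeom.congr_fun fun n => ?_
      rw [← Real.exp_nat_mul, Int.cast_natCast, Nat.abs_cast, mul_neg, mul_comm]
    · refine (hgeom.mul_left (Real.exp (-s))).congr_fun fun n => ?_
      have habs : |((-(n + 1 : ℤ) : ℤ) : ℝ)| = n + 1 := by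
        push_cast
        rw [abs_neg, abs_of_nonneg (by positivity)]
      rw [← Real.exp_nat_mul, ← Real.exp_add, habs]
      ring_nf
  rw [← ENNReal.ofReal_tsum_of_nonneg (fun _ => (Real.exp_pos _).le) key.summable, key.tsum_eq]
  refine ENNReal.ofReal_le_ofReal ?_
  have hlow : s / 2 ≤ 1 - Real.exp (-s) := by
    have h1 : Real.exp (-s) * Real.exp s = 1 := by rw [← Real.exp_add]; simp
    nlinarith [Real.add_one_le_exp s]
  have hinv : (1 - Real.exp (-s))⁻¹ ≤ 2 / s := by
    rw [← inv_div]
    exact inv_anti₀ (by positivity) hlow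
  have : 4 / s = 2 / s + 1 * (2 / s) := by ring
  rw [this]
  gcongr

theorem Real.rpow_le_mul_exp {p u : ℝ} (hp : 0 ≤ p) (hu : 0 ≤ u) :
    u ^ p ≤ (p + 1) ^ p * Real.exp u := by
  have hp1 : 0 < p + 1 := by positivity
  calc u ^ p ≤ ((p + 1) * Real.exp (u / (p + 1))) ^ p := by
        gcongr
        rw [← div_le_iff₀' hp1]
        linarith [Real.add_one_le_exp (u / (p + 1))]
    _ = (p + 1) ^ p * Real.exp (u / (p + 1) * p) := by
        rw [Real.mul_rpow hp1.le (Real.exp_pos _).le, ← Real.exp_mul]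
    _ ≤ (p + 1) ^ p * Real.exp u := by
        gcongr
        rw [div_mul_eq_mul_div, div_le_iff₀ hp1]
        nlinarith

section Lattice

variable {d : ℕ}

theorem latNorm_eq_norm (a : Fin d → ℤ) :
    latNorm a = ‖WithLp.toLp 2 fun i => (a i : ℝ)‖ := by
  simp [latNorm, EuclideanSpace.norm_eq]

theorem latNorm_nonneg (a : Fin d → ℤ) : 0 ≤ latNorm a := Real.sqrt_nonneg _

theorem latNorm_add_le (a b : Fin d → ℤ) : latNorm (a + b) ≤ latNorm a + latNorm b := by
  simp only [latNorm_eq_norm]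
  have h := norm_add_le (WithLp.toLp 2 fun i => (a i : ℝ)) (WithLp.toLp 2 fun i => (b i : ℝ))
  rw [← WithLp.toLp_add] at h
  simpa only [Pi.add_def, Int.cast_add] using h

theorem abs_apply_le_latNorm (a : Fin d → ℤ) (i : Fin d) : |(a i : ℝ)| ≤ latNorm a := by
  rw [latNorm_eq_norm]
  exact PiLp.norm_apply_le (WithLp.toLp 2 fun i => (a i : ℝ)) i

theorem max_latNorm_one_le (a b : Fin d → ℤ) :
    max (latNorm a) 1 ≤ 2 * (max (latNorm (a - b)) 1 * max (latNorm b) 1) := by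
  have h := latNorm_add_le (a - b) b
  rw [sub_add_cancel] at h
  have h1 := le_max_left (latNorm (a - b)) 1
  have h2 := le_max_right (latNorm (a - b)) 1
  have h3 := le_max_left (latNorm b) 1
  have h4 := le_max_right (latNorm b) 1
  refine max_le ?_ ?_ <;> nlinarith

theorem tsum_exp_neg_mul_latNorm_le (hd : 1 ≤ d) {s : ℝ} (hs : 0 < s) (hs1 : s ≤ 1) :
    ∑' c : Fin d → ℤ, ENNReal.ofReal (Real.exp (-(s * latNorm c))) ≤
      ENNReal.ofReal ((4 * d / s) ^ d) := by
  have hd' : (1 : ℝ) ≤ d := by exact_mod_cast hd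
  have hsd : 0 < s / d := by positivity
  have hsd1 : s / d ≤ 1 := (div_le_one (by positivity)).2 (hs1.trans hd')
  calc ∑' c : Fin d → ℤ, ENNReal.ofReal (Real.exp (-(s * latNorm c)))
      ≤ ∑' c : Fin d → ℤ, ∏ i, ENNReal.ofReal (Real.exp (-(s / d * |(c i : ℝ)|))) := by
        gcongr with c
        rw [← ENNReal.ofReal_prod_of_nonneg fun _ _ => (Real.exp_pos _).le, ← Real.exp_sum]
        gcongr
        rw [Finset.sum_neg_distrib, neg_le_neg_iff, ← Finset.mul_sum]
        have hsum : ∑ i, |(c i : ℝ)| ≤ d * latNorm c := by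
          simpa using Finset.sum_le_sum fun i (_ : i ∈ Finset.univ) => abs_apply_le_latNorm c i
        calc s / d * ∑ i, |(c i : ℝ)| ≤ s / d * (d * latNorm c) := by gcongr
          _ = s * latNorm c := by field_simp
    _ = (∑' n : ℤ, ENNReal.ofReal (Real.exp (-(s / d * |(n : ℝ)|)))) ^ d :=
        ENNReal.tsum_pi_prod_eq_pow
          (fun n : ℤ => ENNReal.ofReal (Real.exp (-(s / d * |(n : ℝ)|)))) d
    _ ≤ ENNReal.ofReal (4 / (s / d)) ^ d := by
        gcongr
        exact tsum_int_exp_neg_mul_abs_le hsd hsd1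
    _ = ENNReal.ofReal ((4 * d / s) ^ d) := by
        rw [← ENNReal.ofReal_pow (by positivity), div_div_eq_mul_div]

theorem max_latNorm_one_rpow_mul_exp_le {p γ : ℝ} (hp : 0 ≤ p) (hγ : 0 < γ) (hγ1 : γ ≤ 1)
    (c : Fin d → ℤ) :
    max (latNorm c) 1 ^ p * Real.exp (-(γ * latNorm c)) ≤
      (2 * (p + 1)) ^ p * Real.exp 1 * γ ^ (-p) * Real.exp (-(γ / 2 * latNorm c)) := by
  have hc := latNorm_nonneg c
  set t := max (latNorm c) 1 with ht
  have ht0 : 0 ≤ t := zero_le_one.trans (le_max_right _ _)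
  have ht1 : t ≤ latNorm c + 1 := max_le (by linarith) (by linarith)
  have hpow : t ^ p = 2 ^ p * γ ^ (-p) * (γ / 2 * t) ^ p := by
    rw [Real.mul_rpow (by positivity) ht0, Real.div_rpow hγ.le zero_le_two, Real.rpow_neg hγ.le]
    have := Real.rpow_pos_of_pos hγ p
    field_simp
  calc t ^ p * Real.exp (-(γ * latNorm c))
      ≤ 2 ^ p * γ ^ (-p) * ((p + 1) ^ p * Real.exp (γ / 2 * t)) *
          Real.exp (-(γ * latNorm c)) := by
        rw [hpow]
        gcongr
        exact Real.rpow_le_mul_exp hp (by positivity)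
    _ = (2 * (p + 1)) ^ p * γ ^ (-p) * Real.exp (γ / 2 * t + -(γ * latNorm c)) := by
        rw [Real.mul_rpow zero_le_two (by positivity), Real.exp_add]
        ring
    _ ≤ (2 * (p + 1)) ^ p * γ ^ (-p) * Real.exp (1 + -(γ / 2 * latNorm c)) := by
        refine mul_le_mul_of_nonneg_left (Real.exp_le_exp.2 ?_) (by positivity)
        nlinarith
    _ = _ := by rw [Real.exp_add]; ring

theorem tsum_max_latNorm_one_rpow_mul_exp_le (hd : 1 ≤ d) {p γ : ℝ} (hp : 0 ≤ p) (hγ : 0 < γ)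
    (hγ1 : γ ≤ 1) :
    ∑' c : Fin d → ℤ, ENNReal.ofReal (max (latNorm c) 1 ^ p * Real.exp (-(γ * latNorm c))) ≤
      ENNReal.ofReal ((2 * (p + 1)) ^ p * Real.exp 1 * (8 * d) ^ d * γ ^ (-((d : ℝ) + p))) := by
  calc _ ≤ ∑' c : Fin d → ℤ, ENNReal.ofReal ((2 * (p + 1)) ^ p * Real.exp 1 * γ ^ (-p)) *
          ENNReal.ofReal (Real.exp (-(γ / 2 * latNorm c))) := by
        gcongr with c
        rw [← ENNReal.ofReal_mul (by positivity)]
        exact ENNReal.ofReal_le_ofReal (max_latNorm_one_rpow_mul_exp_le hp hγ hγ1 c)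
    _ ≤ ENNReal.ofReal ((2 * (p + 1)) ^ p * Real.exp 1 * γ ^ (-p)) *
          ENNReal.ofReal ((4 * d / (γ / 2)) ^ d) := by
        rw [ENNReal.tsum_mul_left]
        gcongr
        exact tsum_exp_neg_mul_latNorm_le hd (by positivity) (by linarith)
    _ = _ := by
        rw [← ENNReal.ofReal_mul (by positivity)]
        congr 1
        have h : 4 * (d : ℝ) / (γ / 2) = 8 * d / γ := by field_simp; norm_num
        rw [h, div_pow, neg_add, Real.rpow_add hγ, Real.rpow_neg hγ.le (d : ℝ), Real.rpow_natCast]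
        ring

end Lattice

/-- **Young-type bound**: an infinite matrix with exponentially decaying off-diagonal
entries, `|M_a^b| ≤ e^{−γ|a−b|}`, is a bounded operator on the weighted `ℓ²` space,
with norm at most `C·γ^{−(d+p)}`. -/
theorem exp_decay_matrix_bounded_on_weighted_l2
    (d : ℕ) (hd : 1 ≤ d) (p : ℝ) (hp : 0 ≤ p) :
    ∃ C : ℝ, 0 < C ∧ ∀ γ : ℝ, 0 < γ → γ ≤ 1 →
      ∀ M : (Fin d → ℤ) → (Fin d → ℤ) → ℂ,
        (∀ a b, ‖M a b‖ ≤ Real.exp (-(γ * latNorm (a - b)))) →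
        ∀ z : (Fin d → ℤ) → ℂ, Summable (fun a => latWeight p a * ‖z a‖ ^ 2) →
          (∀ a, Summable (fun b => M a b * z b)) ∧
          Summable (fun a => latWeight p a * ‖∑' b, M a b * z b‖ ^ 2) ∧
          Real.sqrt (∑' a, latWeight p a * ‖∑' b, M a b * z b‖ ^ 2) ≤
            C * γ ^ (-((d : ℝ) + p)) *
              Real.sqrt (∑' a, latWeight p a * ‖z a‖ ^ 2) := by
  refine ⟨2 ^ p * ((2 * (p + 1)) ^ p * Real.exp 1 * (8 * d) ^ d), by positivity,
    fun γ hγ hγ1 M hM z hz => ?_⟩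
  set B : ℝ := (2 * (p + 1)) ^ p * Real.exp 1 * (8 * d) ^ d * γ ^ (-((d : ℝ) + p)) with hB
  have hB0 : 0 ≤ B := by positivity
  set J : (Fin d → ℤ) → ℝ := fun a => max (latNorm a) 1 ^ p with hJ
  have hJ1 (a) : 1 ≤ J a := Real.one_le_rpow (le_max_right _ _) hp
  have hJ0 (a) : 0 ≤ J a := zero_le_one.trans (hJ1 a)
  have hweight (a : Fin d → ℤ) (x : ℂ) :
      ENNReal.ofReal (latWeight p a * ‖x‖ ^ 2) = (ENNReal.ofReal (J a) * ‖x‖ₑ) ^ 2 := by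
    have hJsq : latWeight p a = J a ^ 2 := by
      rw [latWeight, mul_comm, Real.rpow_mul (by positivity), Real.rpow_two]
    rw [hJsq, ← mul_pow, ENNReal.ofReal_pow (mul_nonneg (hJ0 a) (norm_nonneg x)),
      ENNReal.ofReal_mul (hJ0 a), ofReal_norm]
  have hweight0 (a : Fin d → ℤ) (x : ℂ) : 0 ≤ latWeight p a * ‖x‖ ^ 2 := by
    rw [latWeight]; positivity
  set k : (Fin d → ℤ) → ℝ≥0∞ := fun c =>
    ENNReal.ofReal (max (latNorm c) 1 ^ p * Real.exp (-(γ * latNorm c))) with hk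
  set w : (Fin d → ℤ) → ℝ≥0∞ := fun b => ENNReal.ofReal (J b) * ‖z b‖ₑ with hw
  have hentry (a b) : ENNReal.ofReal (J a) * ‖M a b * z b‖ₑ ≤
      ENNReal.ofReal (2 ^ p) * (k (a - b) * w b) := by
    have hJle : J a ≤ 2 ^ p * (max (latNorm (a - b)) 1 ^ p * J b) := by
      simp only [hJ]
      rw [← Real.mul_rpow (by positivity) (by positivity),
        ← Real.mul_rpow (by positivity) (by positivity)]
      exact Real.rpow_le_rpow (by positivity) (max_latNorm_one_le a b) hp
    simp only [hk, hw]
    rw [← ofReal_norm, ← ofReal_norm, ← ENNReal.ofReal_mul (hJ0 a), ← ENNReal.ofReal_mul (hJ0 b),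
      ← ENNReal.ofReal_mul (by positivity), ← ENNReal.ofReal_mul (by positivity), norm_mul]
    refine ENNReal.ofReal_le_ofReal ?_
    calc J a * (‖M a b‖ * ‖z b‖)
        ≤ (2 ^ p * (max (latNorm (a - b)) 1 ^ p * J b)) *
            (Real.exp (-(γ * latNorm (a - b))) * ‖z b‖) := by
          have := hJ0 b
          gcongr
          exact hM a b
      _ = _ := by ring
  have hz_tsum : ∑' b, w b ^ 2 = ENNReal.ofReal (∑' a, latWeight p a * ‖z a‖ ^ 2) := by
    rw [ENNReal.ofReal_tsum_of_nonneg (fun a => hweight0 a _) hz]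
    exact tsum_congr fun a => (hweight a (z a)).symm
  have hyoung : ∑' a, (ENNReal.ofReal (2 ^ p) * ∑' b, k (a - b) * w b) ^ 2 ≤
      ENNReal.ofReal ((2 ^ p * B) ^ 2 * ∑' a, latWeight p a * ‖z a‖ ^ 2) := by
    simp_rw [mul_pow]
    rw [ENNReal.tsum_mul_left, ENNReal.ofReal_mul (by positivity),
      ENNReal.ofReal_mul (by positivity), ENNReal.ofReal_pow (by positivity),
      ENNReal.ofReal_pow hB0, mul_assoc, ← hz_tsum]
    gcongr
    refine (ENNReal.tsum_sq_conv_le k w).trans ?_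
    gcongr
    exact tsum_max_latNorm_one_rpow_mul_exp_le hd hp hγ hγ1
  have hrow (a) : ∑' b, ENNReal.ofReal (J a) * ‖M a b * z b‖ₑ ≤
      ENNReal.ofReal (2 ^ p) * ∑' b, k (a - b) * w b := by
    rw [← ENNReal.tsum_mul_left]
    exact ENNReal.tsum_le_tsum (hentry a)
  have hsummable (a) : Summable fun b => M a b * z b := by
    have hfin := ENNReal.ne_top_of_tsum_ne_top (hyoung.trans_lt ENNReal.ofReal_lt_top).ne a
    refine .of_enorm (ne_top_of_le_ne_top (fun h => hfin (by simp [h])) (le_trans ?_ (hrow a)))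
    gcongr with b
    exact le_mul_of_one_le_left' (by simpa using hJ1 a)
  have htotal : ∑' a, ENNReal.ofReal (latWeight p a * ‖∑' b, M a b * z b‖ ^ 2) ≤
      ENNReal.ofReal ((2 ^ p * B) ^ 2 * ∑' a, latWeight p a * ‖z a‖ ^ 2) := by
    refine le_trans (ENNReal.tsum_le_tsum fun a => ?_) hyoung
    rw [hweight]
    refine pow_le_pow_left' (le_trans ?_ (hrow a)) 2
    rw [ENNReal.tsum_mul_left]
    gcongr
    exact enorm_tsum_le_tsum_enorm
  have hsum : Summable fun a => latWeight p a * ‖∑' b, M a b * z b‖ ^ 2 := by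
    have h := ENNReal.summable_toReal (htotal.trans_lt ENNReal.ofReal_lt_top).ne
    exact h.congr fun a => ENNReal.toReal_ofReal (hweight0 a _)
  refine ⟨hsummable, hsum, ?_⟩
  rw [← ENNReal.ofReal_tsum_of_nonneg (fun a => hweight0 a _) hsum,
    ENNReal.ofReal_le_ofReal_iff (mul_nonneg (sq_nonneg _) (tsum_nonneg fun a => hweight0 a _))]
    at htotal
  calc _ ≤ √((2 ^ p * B) ^ 2 * ∑' a, latWeight p a * ‖z a‖ ^ 2) := Real.sqrt_le_sqrt htotal
    _ = _ := by
      rw [Real.sqrt_mul (sq_nonneg _), Real.sqrt_sq (by positivity), hB]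
      ring
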